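/- Let G be a connected coloured graph, S an optimal (minimum length) sequence of moves linking vertices u and v, and P a critical u-v path with respect to S. Then every move of S is played in a monochromatic area intersecting P (at the time the move is made). -/

import Mathlib

namespace Flood

variable {V C : Type*}

/-- Two vertices are joined by an edge inside a monochromatic class. -/
def monoAdj (G : SimpleGraph V) (ω : V → C) (a b : V) : Prop :=
  G.Adj a b ∧ ω a = ω b

/-- `u` and `v` lie in a common monochromatic component of the colouring `ω`. -/
def monoLinked (G : SimpleGraph V) (ω : V → C) (u v : V) : Prop :=
  Relation.ReflTransGen (monoAdj G ω) u v

/-- One flooding move: recolour the monochromatic component of `v` with colour `d`. -/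
noncomputable def floodMove (G : SimpleGraph V) (ω : V → C) (v : V) (d : C) : V → C :=
  fun u => @ite _ (monoLinked G ω v u) (Classical.propDecidable _) d (ω u)

/-- Apply a sequence of flooding moves. -/
noncomputable def floodSeq (G : SimpleGraph V) (ω : V → C) (S : List (V × C)) : V → C :=
  S.foldl (fun ω' m => floodMove G ω' m.1 m.2) ω

/-- The sequence `S` floods `G`, i.e. makes it monochromatic. -/
def Floods (G : SimpleGraph V) (ω : V → C) (S : List (V × C)) : Prop :=
  ∀ a b, floodSeq G ω S a = floodSeq G ω S b

/-- Minimum number of moves needed to make `G` monochromatic. -/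
noncomputable def floodCost (G : SimpleGraph V) (ω : V → C) : ℕ :=
  sInf {k | ∃ S, S.length = k ∧ Floods G ω S}

/-- Minimum number of moves needed to make `G` monochromatic in colour `d`. -/
noncomputable def floodCostIn (G : SimpleGraph V) (ω : V → C) (d : C) : ℕ :=
  sInf {k | ∃ S, S.length = k ∧ ∀ a, floodSeq G ω S a = d}

/-- The sequence `S` links `u` and `v`. -/
def Links (G : SimpleGraph V) (ω : V → C) (S : List (V × C)) (u v : V) : Prop :=
  monoLinked G (floodSeq G ω S) u v

/-- Minimum number of moves needed to link `u` and `v`. -/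
noncomputable def linkCost (G : SimpleGraph V) (ω : V → C) (u v : V) : ℕ :=
  sInf {k | ∃ S, S.length = k ∧ Links G ω S u v}

/-- Minimum number of moves needed to link `u` and `v` in a monochromatic
component of colour `d`. -/
noncomputable def linkCostIn (G : SimpleGraph V) (ω : V → C) (u v : V) (d : C) : ℕ :=
  sInf {k | ∃ S, S.length = k ∧ Links G ω S u v ∧ floodSeq G ω S u = d}


/-- `x` and `y` are linked along the given edge set: they are joined by a
monochromatic chain using only those edges. -/
def monoLinkedAlong (edges : List (Sym2 V)) (ω : V → C) (x y : V) : Prop :=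
  Relation.ReflTransGen (fun a b => s(a, b) ∈ edges ∧ ω a = ω b) x y

/-- A walk `P` is critical with respect to a move sequence `S`: at no point of
the play are two vertices of `P` linked in `G` without being linked along `P`. -/
def Critical (G : SimpleGraph V) (ω : V → C) (S : List (V × C))
    {u v : V} (P : G.Walk u v) : Prop :=
  ∀ x ∈ P.support, ∀ y ∈ P.support, ∀ k : ℕ,
    monoLinked G (floodSeq G ω (S.take k)) x y →
      monoLinkedAlong P.edges (floodSeq G ω (S.take k)) x y

end Flood

namespace Flood

section Plan

variable {V C : Type*} [DecidableEq V]

/-- `FloodPlan adj col A d n`: the set `A` of initially coloured pieces can be brought to the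
single colour `d` using `n` recolourings, by repeatedly recolouring an already unified set of
pieces and merging disjoint neighbouring unified sets of equal colour. -/
inductive FloodPlan (adj : V → V → Prop) (col : V → C) : Finset V → C → ℕ → Prop
  | single (x : V) : FloodPlan adj col {x} (col x) 0
  | recolour {A : Finset V} {c : C} {n : ℕ} (d : C) :
      FloodPlan adj col A c n → FloodPlan adj col A d (n + 1)
  | join {A B : Finset V} {d : C} {m n : ℕ} :
      FloodPlan adj col A d m → FloodPlan adj col B d n → Disjoint A B →
      (∃ a ∈ A, ∃ b ∈ B, adj a b) → FloodPlan adj col (A ∪ B) d (m + n)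

namespace FloodPlan

variable {adj adj' : V → V → Prop} {col col' : V → C} {A B : Finset V} {c d e : C} {m n : ℕ}

theorem nonempty (h : FloodPlan adj col A d n) : A.Nonempty := by
  induction h with
  | single x => exact Finset.singleton_nonempty x
  | recolour d _ ih => exact ih
  | join _ _ _ _ ih _ => exact ih.mono Finset.subset_union_left

theorem mono_length (h : FloodPlan adj col A d m) (hmn : m ≤ n) : FloodPlan adj col A d n := by
  induction hmn with
  | refl => exact h
  | step _ ih => exact ih.recolour d

theorem mono_adj (h : FloodPlan adj col A d n) (hadj : ∀ a b, adj a b → adj' a b) :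
    FloodPlan adj' col A d n := by
  induction h with
  | single x => exact single x
  | recolour d _ ih => exact ih.recolour d
  | join _ _ hd ht ih₁ ih₂ =>
    obtain ⟨a, ha, b, hb, hab⟩ := ht
    exact ih₁.join ih₂ hd ⟨a, ha, b, hb, hadj a b hab⟩

theorem congr_col (h : FloodPlan adj col A d n) (hcol : ∀ a ∈ A, col' a = col a) :
    FloodPlan adj col' A d n := by
  induction h with
  | single x =>
    rw [← hcol x (Finset.mem_singleton_self x)]
    exact single x
  | recolour d _ ih => exact (ih hcol).recolour d
  | join _ _ hd ht ih₁ ih₂ =>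
    exact (ih₁ fun a ha => hcol a (Finset.mem_union_left _ ha)).join
      (ih₂ fun a ha => hcol a (Finset.mem_union_right _ ha)) hd ht

/-- A bound on the total size below which plans for the same colour may be united, whether they
overlap or are only adjacent. -/
def UnionBelow (adj : V → V → Prop) (col : V → C) (s : ℕ) : Prop :=
  ∀ (A B : Finset V) (d : C) (m n : ℕ), A.card + B.card < s →
    FloodPlan adj col A d m → FloodPlan adj col B d n →
    (∃ a ∈ A, ∃ b ∈ B, adj a b) → FloodPlan adj col (A ∪ B) d (m + n)

theorem card_union_lt {x : V} (hA : x ∈ A) (hB : x ∈ B) : (A ∪ B).card < A.card + B.card := by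
  have h := Finset.card_union_add_card_inter A B
  have : 0 < (A ∩ B).card := Finset.card_pos.mpr ⟨x, Finset.mem_inter.mpr ⟨hA, hB⟩⟩
  omega

/-- In a plan for `A`, a piece `x` may be replaced by a plan unifying `B ∋ x` in the colour
of `x`. -/
theorem substitute (hs : ∀ a b, adj a b → adj b a) {s : ℕ} (hU : UnionBelow adj col s) {x : V}
    (hxB : x ∈ B) (hB : FloodPlan adj col B (col x) n) (hA : FloodPlan adj col A d m)
    (hxA : x ∈ A) (hcard : A.card + B.card ≤ s) : FloodPlan adj col (A ∪ B) d (m + n) := by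
  induction hA with
  | single y =>
    obtain rfl := Finset.mem_singleton.mp hxA
    rw [Finset.union_eq_right.mpr (Finset.singleton_subset_iff.mpr hxB), Nat.zero_add]
    exact hB
  | recolour d _ ih =>
    rw [Nat.add_right_comm]
    exact (ih hxA hcard).recolour d
  | @join A₁ A₂ d m₁ m₂ h₁ h₂ hd ht ih₁ ih₂ =>
    rw [Finset.card_union_of_disjoint hd] at hcard
    obtain ⟨a, ha, b, hb, hab⟩ := ht
    rcases Finset.mem_union.mp hxA with hx | hx
    · have hlt := card_union_lt hx hxB
      have := hU _ _ _ _ _ (by omega) (ih₁ hx (by omega)) h₂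
        ⟨a, Finset.mem_union_left _ ha, b, hb, hab⟩
      rwa [Finset.union_right_comm, Nat.add_right_comm] at this
    · have hlt := card_union_lt hx hxB
      have := hU _ _ _ _ _ (by omega) (ih₂ hx (by omega)) h₁
        ⟨b, Finset.mem_union_left _ hb, a, ha, hs _ _ hab⟩
      rwa [Finset.union_right_comm, Finset.union_comm A₂, Nat.add_right_comm,
        Nat.add_comm m₂] at this

/-- If `x` is a common piece of two plans, then either the second one ends in the colour of `x`,
or it can be carried out after the first one at no extra cost. -/
theorem eq_col_or_union (hs : ∀ a b, adj a b → adj b a) {s : ℕ} (hU : UnionBelow adj col s)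
    {x : V} (hxA : x ∈ A) (hA : FloodPlan adj col A d m) (hB : FloodPlan adj col B e n)
    (hxB : x ∈ B) (hcard : A.card + B.card ≤ s) :
    e = col x ∨ FloodPlan adj col (A ∪ B) e (m + n) := by
  induction hB with
  | single y =>
    obtain rfl := Finset.mem_singleton.mp hxB
    exact Or.inl rfl
  | recolour e hB ih =>
    right
    rcases ih hxB hcard with h | h
    · exact (substitute hs hU hxB (h ▸ hB) hA hxA hcard).recolour e
    · exact h.recolour e
  | @join B₁ B₂ e n₁ n₂ h₁ h₂ hd ht ih₁ ih₂ =>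
    rw [Finset.card_union_of_disjoint hd] at hcard
    obtain ⟨a, ha, b, hb, hab⟩ := ht
    rcases Finset.mem_union.mp hxB with hx | hx
    · refine (ih₁ hx (by omega)).imp_right fun h => ?_
      have hlt := card_union_lt hxA hx
      have := hU _ _ _ _ _ (by omega) h h₂ ⟨a, Finset.mem_union_right _ ha, b, hb, hab⟩
      rwa [Finset.union_assoc, Nat.add_assoc] at this
    · refine (ih₂ hx (by omega)).imp_right fun h => ?_
      have hlt := card_union_lt hxA hx
      have := hU _ _ _ _ _ (by omega) h h₁ ⟨b, Finset.mem_union_right _ hb, a, ha, hs _ _ hab⟩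
      rwa [Finset.union_assoc, Nat.add_assoc, Finset.union_comm B₂, Nat.add_comm n₂] at this

theorem union_of_mem (hs : ∀ a b, adj a b → adj b a) {s : ℕ} (hU : UnionBelow adj col s) {x : V}
    (hA : FloodPlan adj col A d m) (hB : FloodPlan adj col B d n) (hxA : x ∈ A) (hxB : x ∈ B)
    (hcard : A.card + B.card ≤ s) : FloodPlan adj col (A ∪ B) d (m + n) := by
  rcases eq_col_or_union hs hU hxA hA hB hxB hcard with h | h
  · exact substitute hs hU hxB (h ▸ hB) hA hxA hcard
  · exact h

theorem unionBelow (hs : ∀ a b, adj a b → adj b a) (s : ℕ) : UnionBelow adj col s := by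
  induction s with
  | zero => exact fun _ _ _ _ _ h => absurd h (Nat.not_lt_zero _)
  | succ s ih =>
    intro A B d m n hcard hA hB ht
    by_cases hd : Disjoint A B
    · exact hA.join hB hd ht
    · obtain ⟨x, hxA, hxB⟩ := Finset.not_disjoint_iff.mp hd
      exact union_of_mem hs ih hA hB hxA hxB (Nat.lt_succ_iff.mp hcard)

/-- Plans may be transported along maps preserving adjacency and colours, even when pieces get
identified. -/
theorem image (hs : ∀ a b, adj' a b → adj' b a) (f : V → V)
    (hadj : ∀ a b, adj a b → adj' (f a) (f b)) (hcol : ∀ a, col' (f a) = col a)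
    (h : FloodPlan adj col A d n) : FloodPlan adj' col' (A.image f) d n := by
  induction h with
  | single x =>
    rw [Finset.image_singleton, ← hcol x]
    exact single (f x)
  | recolour d _ ih => exact ih.recolour d
  | join _ _ _ ht ih₁ ih₂ =>
    obtain ⟨a, ha, b, hb, hab⟩ := ht
    rw [Finset.image_union]
    exact unionBelow hs _ _ _ _ _ _ (Nat.lt_succ_self _) ih₁ ih₂
      ⟨f a, Finset.mem_image_of_mem f ha, f b, Finset.mem_image_of_mem f hb, hadj a b hab⟩

/-- A connected set partitioned into parts that have plans for a common colour has a plan, for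
any cost function that is superadditive on unions of parts. -/
theorem of_partition {K : Finset V} {x : V} (hx : x ∈ K) (p : V → Finset V)
    (cost : Finset V → ℕ) (hself : ∀ y ∈ K, y ∈ p y) (hsub : ∀ y ∈ K, p y ⊆ K)
    (hpart : ∀ y ∈ K, ∀ z ∈ p y, p z = p y)
    (hplan : ∀ y ∈ K, FloodPlan adj col (p y) d (cost (p y)))
    (hcost : ∀ Z ⊆ K, (∀ z ∈ Z, p z ⊆ Z) → ∀ y ∈ K, y ∉ Z →
      cost Z + cost (p y) ≤ cost (Z ∪ p y))
    (hconn : ∀ y ∈ K, Relation.ReflTransGen (fun a b => adj a b ∧ b ∈ K) x y) :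
    FloodPlan adj col K d (cost K) := by
  classical
  let F := K.powerset.filter fun Z =>
    x ∈ Z ∧ (∀ z ∈ Z, p z ⊆ Z) ∧ FloodPlan adj col Z d (cost Z)
  have hF : F.Nonempty :=
    ⟨p x, Finset.mem_filter.mpr ⟨Finset.mem_powerset.mpr (hsub x hx), hself x hx,
      fun z hz => (hpart x hx z hz).subset, hplan x hx⟩⟩
  obtain ⟨Z, hZF, hmax⟩ := F.exists_max_image Finset.card hF
  obtain ⟨hZK, hxZ, hcl, hZ⟩ := Finset.mem_filter.mp hZF
  rw [Finset.mem_powerset] at hZK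
  suffices h : ∀ y ∈ K, y ∈ Z by
    rwa [Finset.Subset.antisymm hZK h] at hZ
  intro y hy
  have hchain := hconn y hy
  clear hy
  induction hchain with
  | refl => exact hxZ
  | @tail a b _ hab ih =>
    by_contra hbZ
    have hdisj : Disjoint Z (p b) := by
      rw [Finset.disjoint_left]
      intro z hz hzb
      exact hbZ (hcl z hz (hpart b hab.2 z hzb ▸ hself b hab.2))
    have hnew : Z ∪ p b ∈ F := by
      refine Finset.mem_filter.mpr ⟨Finset.mem_powerset.mpr
        (Finset.union_subset hZK (hsub b hab.2)), Finset.mem_union_left _ hxZ, ?_, ?_⟩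
      · intro z hz
        rcases Finset.mem_union.mp hz with hz | hz
        · exact (hcl z hz).trans Finset.subset_union_left
        · exact (hpart b hab.2 z hz).subset.trans Finset.subset_union_right
      · exact (hZ.join (hplan b hab.2) hdisj ⟨a, ih, b, hself b hab.2, hab.1⟩).mono_length
          (hcost Z hZK hcl b hab.2 hbZ)
    have := hmax _ hnew
    rw [Finset.card_union_of_disjoint hdisj] at this
    have : 0 < (p b).card := Finset.card_pos.mpr ⟨b, hself b hab.2⟩
    omega

end FloodPlan

end Plan

section Play

variable {V C : Type*} {G : SimpleGraph V} {ω : V → C} {a b w : V} {d : C}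

theorem monoLinked.symm (h : monoLinked G ω a b) : monoLinked G ω b a :=
  have : Std.Symm (monoAdj G ω) := ⟨fun _ _ h => ⟨h.1.symm, h.2.symm⟩⟩
  Relation.ReflTransGen.stdSymm.symm _ _ h

theorem monoLinked.trans {c : V} (h : monoLinked G ω a b) (h' : monoLinked G ω b c) :
    monoLinked G ω a c :=
  Relation.ReflTransGen.trans h h'

theorem monoLinked.col_eq (h : monoLinked G ω a b) : ω a = ω b := by
  induction h with
  | refl => rfl
  | tail _ h ih => exact ih.trans h.2

theorem floodMove_of_linked (h : monoLinked G ω w a) : floodMove G ω w d a = d :=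
  if_pos h

theorem floodMove_of_not_linked (h : ¬ monoLinked G ω w a) : floodMove G ω w d a = ω a :=
  if_neg h

theorem monoLinked.floodMove (h : monoLinked G ω a b) (w : V) (d : C) :
    monoLinked G (floodMove G ω w d) a b := by
  induction h with
  | refl => exact Relation.ReflTransGen.refl
  | @tail x y _ hxy ih =>
    refine ih.tail ⟨hxy.1, ?_⟩
    have hl : monoLinked G ω x y := Relation.ReflTransGen.single hxy
    by_cases hx : monoLinked G ω w x
    · rw [floodMove_of_linked hx, floodMove_of_linked (hx.trans hl)]
    · rw [floodMove_of_not_linked hx, floodMove_of_not_linked fun hy => hx (hy.trans hl.symm)]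
      exact hxy.2

theorem monoLinked.floodSeq (S : List (V × C)) (h : monoLinked G ω a b) :
    monoLinked G (floodSeq G ω S) a b := by
  induction S generalizing ω with
  | nil => exact h
  | cons m S ih => exact ih (h.floodMove m.1 m.2)

/-- The monochromatic components of `a` and `b` are joined by an edge. -/
def areaAdj (G : SimpleGraph V) (ω : V → C) (a b : V) : Prop :=
  ∃ a' b', monoLinked G ω a a' ∧ monoLinked G ω b b' ∧ G.Adj a' b'

theorem areaAdj.symm (h : areaAdj G ω a b) : areaAdj G ω b a := by
  obtain ⟨a', b', ha, hb, hab⟩ := h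
  exact ⟨b', a', hb, ha, hab.symm⟩

theorem exists_area_representative (G : SimpleGraph V) (ω : V → C) :
    ∃ f : V → V, (∀ a, monoLinked G ω a (f a)) ∧ ∀ a b, monoLinked G ω a b → f a = f b := by
  let s : Setoid V := ⟨monoLinked G ω, fun _ => Relation.ReflTransGen.refl,
    fun h => h.symm, fun h h' => h.trans h'⟩
  refine ⟨fun a => (Quotient.mk s a).out, fun a => ?_, fun a b h => ?_⟩
  · exact monoLinked.symm (Quotient.mk_out (s := s) a)
  · exact congrArg Quotient.out (Quotient.sound (s := s) h)

variable [DecidableEq V] {A : Finset V} {n : ℕ}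

namespace FloodPlan

theorem linked_of_zero (h : FloodPlan (areaAdj G ω) ω A d 0) :
    (∀ a ∈ A, ω a = d) ∧ ∀ a ∈ A, ∀ b ∈ A, monoLinked G ω a b := by
  generalize hn : 0 = n at h
  induction h with
  | single x =>
    simp only [Finset.mem_singleton, forall_eq, true_and]
    exact Relation.ReflTransGen.refl
  | recolour d _ ih => omega
  | join _ _ _ ht ih₁ ih₂ =>
    obtain ⟨c₁, l₁⟩ := ih₁ (by omega)
    obtain ⟨c₂, l₂⟩ := ih₂ (by omega)
    obtain ⟨a, ha, b, hb, a', b', haa, hbb, hab⟩ := ht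
    have hl : monoLinked G ω a b := by
      refine (Relation.ReflTransGen.tail haa ⟨hab, ?_⟩ : monoLinked G ω a b').trans hbb.symm
      rw [← haa.col_eq, ← hbb.col_eq, c₁ a ha, c₂ b hb]
    refine ⟨fun x hx => (Finset.mem_union.mp hx).elim (c₁ x) (c₂ x), fun x hx y hy => ?_⟩
    rcases Finset.mem_union.mp hx with hx | hx <;> rcases Finset.mem_union.mp hy with hy | hy
    · exact l₁ x hx y hy
    · exact (l₁ x hx a ha).trans (hl.trans (l₂ b hb y hy))
    · exact (l₂ x hx b hb).trans (hl.symm.trans (l₁ a ha y hy))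
    · exact l₂ x hx y hy

/-- If the pieces of a plan lie in distinct areas, some move makes the plan shorter. -/
theorem exists_move (h : FloodPlan (areaAdj G ω) ω A d (n + 1))
    (hA : ∀ a ∈ A, ∀ b ∈ A, monoLinked G ω a b → a = b) :
    ∃ w ∈ A, ∃ e, FloodPlan (areaAdj G ω) (floodMove G ω w e) A d n := by
  have aux {A B : Finset V} {w : V} {d e : C} {k : ℕ} (hw : w ∈ A)
      (hAB : ∀ a ∈ A ∪ B, ∀ b ∈ A ∪ B, monoLinked G ω a b → a = b) (hd : Disjoint A B)
      (hB : FloodPlan (areaAdj G ω) ω B d k) :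
      FloodPlan (areaAdj G ω) (floodMove G ω w e) B d k := by
    refine hB.congr_col fun b hb => floodMove_of_not_linked fun hwb => ?_
    have := hAB w (Finset.mem_union_left _ hw) b (Finset.mem_union_right _ hb) hwb
    exact Finset.disjoint_left.mp hd hw (this ▸ hb)
  generalize hk : n + 1 = k at h
  induction h generalizing n with
  | single x => omega
  | @recolour A c k d h ih =>
    obtain rfl : n = k := by omega
    cases n with
    | zero =>
      obtain ⟨w, hw⟩ := h.nonempty
      have hAw : A = {w} := Finset.eq_singleton_iff_unique_mem.mpr
        ⟨hw, fun y hy => hA y hy w hw (h.linked_of_zero.2 y hy w hw)⟩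
      refine ⟨w, hw, d, ?_⟩
      have := single (adj := areaAdj G ω) (col := floodMove G ω w d) w
      rwa [floodMove_of_linked Relation.ReflTransGen.refl, ← hAw] at this
    | succ n =>
      obtain ⟨w, hw, e, h'⟩ := ih hA rfl
      exact ⟨w, hw, e, h'.recolour d⟩
  | @join A B d m k h₁ h₂ hd ht ih₁ ih₂ =>
    cases m with
    | succ m =>
      obtain ⟨w, hw, e, h'⟩ := ih₁ (n := m) (fun a ha b hb =>
        hA a (Finset.mem_union_left _ ha) b (Finset.mem_union_left _ hb)) rfl
      obtain rfl : n = m + k := by omega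
      exact ⟨w, Finset.mem_union_left _ hw, e, h'.join (aux hw hA hd h₂) hd ht⟩
    | zero =>
      obtain ⟨w, hw, e, h'⟩ := ih₂ (n := n) (fun a ha b hb =>
        hA a (Finset.mem_union_right _ ha) b (Finset.mem_union_right _ hb)) (by omega)
      refine ⟨w, Finset.mem_union_right _ hw, e, ?_⟩
      rw [← Nat.zero_add n]
      exact (aux hw (Finset.union_comm A B ▸ hA) hd.symm h₁).join h' hd ht

theorem exists_play (h : FloodPlan (areaAdj G ω) ω A d n) :
    ∃ S : List (V × C), S.length ≤ n ∧ ∀ a ∈ A, ∀ b ∈ A, monoLinked G (floodSeq G ω S) a b := by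
  induction n generalizing ω A with
  | zero => exact ⟨[], le_rfl, h.linked_of_zero.2⟩
  | succ n ih =>
    obtain ⟨f, hf, hf'⟩ := exists_area_representative G ω
    have himage : FloodPlan (areaAdj G ω) ω (A.image f) d (n + 1) := by
      refine h.image (fun _ _ => areaAdj.symm) f (fun a b hab => ?_) fun a => (hf a).col_eq.symm
      obtain ⟨a', b', ha, hb, hab⟩ := hab
      exact ⟨a', b', (hf a).symm.trans ha, (hf b).symm.trans hb, hab⟩
    obtain ⟨w, -, e, hw⟩ := himage.exists_move fun x hx y hy hxy => by
      obtain ⟨a, -, rfl⟩ := Finset.mem_image.mp hx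
      obtain ⟨b, -, rfl⟩ := Finset.mem_image.mp hy
      exact hf' a b ((hf a).trans (hxy.trans (hf b).symm))
    obtain ⟨S, hlen, hS⟩ := ih (hw.mono_adj (adj' := areaAdj G (floodMove G ω w e)) fun a b hab => by
      obtain ⟨a', b', ha, hb, hab⟩ := hab
      exact ⟨a', b', ha.floodMove w e, hb.floodMove w e, hab⟩)
    have hext (a : V) : monoLinked G (floodSeq G ω ((w, e) :: S)) a (f a) :=
      (hf a).floodSeq _
    refine ⟨(w, e) :: S, Nat.succ_le_succ hlen, fun a ha b hb => ?_⟩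
    exact (hext a).trans ((hS _ (Finset.mem_image_of_mem f ha) _
      (Finset.mem_image_of_mem f hb)).trans (hext b).symm)

end FloodPlan

end Play

section Trace

open Classical in
/-- The times before `t` at which the area played in meets `K`. -/
noncomputable def hitTimes {V C : Type*} (G : SimpleGraph V) (c : ℕ → V → C) (w : ℕ → V) (t : ℕ)
    (K : Finset V) : Finset ℕ :=
  (Finset.range t).filter fun i => ∃ y ∈ K, monoLinked G (c i) (w i) y

variable {V C : Type*} {G : SimpleGraph V} {c : ℕ → V → C} {w : ℕ → V} {d : ℕ → C} {N : ℕ}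

theorem mem_hitTimes {t i : ℕ} {K : Finset V} :
    i ∈ hitTimes G c w t K ↔ i < t ∧ ∃ y ∈ K, monoLinked G (c i) (w i) y := by
  simp [hitTimes]

theorem monoLinked_of_le (hc : ∀ i < N, c (i + 1) = floodMove G (c i) (w i) (d i)) {i j : ℕ}
    (hij : i ≤ j) (hj : j ≤ N) {a b : V} (h : monoLinked G (c i) a b) : monoLinked G (c j) a b := by
  induction hij with
  | refl => exact h
  | @step j _ ih =>
    rw [hc j (by omega)]
    exact (ih (by omega)).floodMove _ _

open Classical in
/-- If linked vertices of `s` are always linked inside `s`, then the part of `s` in each area at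
time `t` has a plan using only as many recolourings as there were moves meeting it. -/
theorem floodPlan_hitTimes (hc : ∀ i < N, c (i + 1) = floodMove G (c i) (w i) (d i))
    (s : Finset V)
    (hcrit : ∀ t, ∀ x ∈ s, ∀ y ∈ s, monoLinked G (c t) x y →
      Relation.ReflTransGen (fun a b => (G.Adj a b ∧ b ∈ s) ∧ c t a = c t b) x y)
    {t : ℕ} (ht : t ≤ N) {x : V} (hx : x ∈ s) :
    FloodPlan G.Adj (c 0) (s.filter (monoLinked G (c t) x)) (c t x)
      (hitTimes G c w t (s.filter (monoLinked G (c t) x))).card := by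
  have hconn (t : ℕ) (x : V) (hx : x ∈ s) (y : V) (hy : y ∈ s.filter (monoLinked G (c t) x)) :
      Relation.ReflTransGen
        (fun a b => G.Adj a b ∧ b ∈ s.filter (monoLinked G (c t) x)) x y := by
    obtain ⟨hys, hxy⟩ := Finset.mem_filter.mp hy
    suffices h : monoLinked G (c t) x y ∧ Relation.ReflTransGen
        (fun a b => G.Adj a b ∧ b ∈ s.filter (monoLinked G (c t) x)) x y from h.2
    have hchain := hcrit t x hx y hys hxy
    clear hxy hys hy
    induction hchain with
    | refl => exact ⟨Relation.ReflTransGen.refl, Relation.ReflTransGen.refl⟩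
    | @tail a b _ hab ih =>
      have hl : monoLinked G (c t) x b := Relation.ReflTransGen.tail ih.1 ⟨hab.1.1, hab.2⟩
      exact ⟨hl, ih.2.tail ⟨hab.1.1, Finset.mem_filter.mpr ⟨hab.1.2, hl⟩⟩⟩
  induction t generalizing x with
  | zero =>
    refine FloodPlan.of_partition (Finset.mem_filter.mpr ⟨hx, Relation.ReflTransGen.refl⟩)
      (fun y => {y}) (fun K => (hitTimes G c w 0 K).card) ?_ ?_ ?_ ?_ ?_ (hconn 0 x hx)
    · exact fun y _ => Finset.mem_singleton_self y
    · exact fun y hy => Finset.singleton_subset_iff.mpr hy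
    · exact fun y _ z hz => by rw [Finset.mem_singleton.mp hz]
    · intro y hy
      rw [monoLinked.col_eq (Finset.mem_filter.mp hy).2]
      exact FloodPlan.single y
    · exact fun Z _ _ y _ _ => le_of_eq rfl
  | succ t ih =>
    have hstep := hc t (by omega)
    have hpart (y z : V) (hz : z ∈ s.filter (monoLinked G (c t) y)) :
        s.filter (monoLinked G (c t) z) = s.filter (monoLinked G (c t) y) := by
      have hyz := (Finset.mem_filter.mp hz).2
      exact Finset.filter_congr fun a _ => ⟨hyz.trans, hyz.symm.trans⟩
    refine FloodPlan.of_partition (Finset.mem_filter.mpr ⟨hx, Relation.ReflTransGen.refl⟩)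
      (fun y => s.filter (monoLinked G (c t) y)) (fun K => (hitTimes G c w (t + 1) K).card)
      ?_ ?_ ?_ ?_ ?_ (hconn (t + 1) x hx)
    · exact fun y hy => Finset.mem_filter.mpr
        ⟨(Finset.mem_filter.mp hy).1, Relation.ReflTransGen.refl⟩
    · intro y hy z hz
      obtain ⟨hzs, hyz⟩ := Finset.mem_filter.mp hz
      exact Finset.mem_filter.mpr ⟨hzs, (Finset.mem_filter.mp hy).2.trans
        (monoLinked_of_le hc (Nat.le_succ t) ht hyz)⟩
    · exact fun y _ z hz => hpart y z hz
    · intro y hy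
      obtain ⟨hys, hxy⟩ := Finset.mem_filter.mp hy
      have hplan := ih (by omega) hys
      rw [monoLinked.col_eq hxy]
      have hsub : hitTimes G c w t (s.filter (monoLinked G (c t) y)) ⊆
          hitTimes G c w (t + 1) (s.filter (monoLinked G (c t) y)) := fun i hi =>
        mem_hitTimes.mpr ⟨(mem_hitTimes.mp hi).1.trans (Nat.lt_succ_self t), (mem_hitTimes.mp hi).2⟩
      by_cases hw : monoLinked G (c t) (w t) y
      · refine (hplan.recolour _).mono_length (Finset.card_lt_card ⟨hsub, fun h => ?_⟩)
        exact lt_irrefl t (mem_hitTimes.mp (h (mem_hitTimes.mpr ⟨Nat.lt_succ_self t, y,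
          Finset.mem_filter.mpr ⟨hys, Relation.ReflTransGen.refl⟩, hw⟩))).1
      · rw [hstep, floodMove_of_not_linked hw]
        exact hplan.mono_length (Finset.card_le_card hsub)
    · intro Z hZ hcl y hy hyZ
      rw [← Finset.card_union_of_disjoint]
      · refine Finset.card_le_card fun i hi => mem_hitTimes.mpr ?_
        rcases Finset.mem_union.mp hi with hi | hi <;>
          obtain ⟨hit, a, ha, hwa⟩ := mem_hitTimes.mp hi
        · exact ⟨hit, a, Finset.mem_union_left _ ha, hwa⟩
        · exact ⟨hit, a, Finset.mem_union_right _ ha, hwa⟩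
      · rw [Finset.disjoint_left]
        intro i hi hi'
        obtain ⟨hit, a, ha, hwa⟩ := mem_hitTimes.mp hi
        obtain ⟨-, b, hb, hwb⟩ := mem_hitTimes.mp hi'
        have hab : monoLinked G (c t) a b :=
          monoLinked_of_le hc (Nat.lt_succ_iff.mp hit) (by omega) (hwa.symm.trans hwb)
        exact hyZ (hcl a ha (Finset.mem_filter.mpr ⟨(Finset.mem_filter.mp hy).1,
          hab.trans (Finset.mem_filter.mp hb).2.symm⟩))

end Trace

end Flood

open Flood

/-- if `S` is an optimal sequence linking `u` and `v` and `P` is a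
critical `u`-`v` path with respect to `S`, then every move of `S` is played in a
monochromatic area meeting `P` (at the time the move is made). -/
theorem optimal_moves_on_critical_path {V C : Type*}
    (G : SimpleGraph V) (hG : G.Connected) (ω : V → C) (u v : V)
    (S : List (V × C)) (hS : Links G ω S u v)
    (hopt : S.length = linkCost G ω u v)
    (P : G.Walk u v) (hP : P.IsPath) (hcrit : Critical G ω S P) :
    ∀ (i : ℕ) (hi : i < S.length), ∃ x ∈ P.support,
      monoLinked G (floodSeq G ω (S.take i)) (S.get ⟨i, hi⟩).1 x := by
  classical
  intro i hi
  by_contra hmiss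
  let c : ℕ → V → C := fun t => floodSeq G ω (S.take t)
  let move : ℕ → V × C := fun t => S.getD t (u, ω u)
  have hmove (t : ℕ) (ht : t < S.length) : move t = S[t] := by
    simp [move, ht]
  have hc : ∀ t < S.length, c (t + 1) = floodMove G (c t) (move t).1 (move t).2 := by
    intro t ht
    simp only [c, floodSeq, hmove t ht]
    rw [List.take_succ_eq_append_getElem ht, List.foldl_append]
    rfl
  have hplan := floodPlan_hitTimes (w := fun t => (move t).1) (d := fun t => (move t).2) hc
    P.support.toFinset (fun t x hx y hy hxy => by
      rw [List.mem_toFinset] at hx hy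
      refine Relation.ReflTransGen.mono (fun a b hab => ?_) _ _ (hcrit x hx y hy t hxy)
      exact
        ⟨⟨P.adj_of_mem_edges hab.1, List.mem_toFinset.mpr (P.snd_mem_support_of_mem_edges hab.1)⟩,
          hab.2⟩)
    le_rfl (List.mem_toFinset.mpr P.start_mem_support)
  obtain ⟨S', hlen, hS'⟩ := (hplan.mono_adj (adj' := areaAdj G (c 0)) fun a b hab =>
    ⟨a, b, Relation.ReflTransGen.refl, Relation.ReflTransGen.refl, hab⟩).exists_play
  have hu : u ∈ P.support.toFinset.filter (monoLinked G (c S.length) u) :=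
    Finset.mem_filter.mpr ⟨List.mem_toFinset.mpr P.start_mem_support, Relation.ReflTransGen.refl⟩
  have hv : v ∈ P.support.toFinset.filter (monoLinked G (c S.length) u) := by
    refine Finset.mem_filter.mpr ⟨List.mem_toFinset.mpr P.end_mem_support, ?_⟩
    simpa only [c, List.take_length, Links] using hS
  have hcost : linkCost G ω u v ≤ S'.length := Nat.sInf_le ⟨S', rfl, hS' u hu v hv⟩
  refine absurd (hopt.trans_le (hcost.trans hlen)) (not_le_of_gt ?_)
  refine (Finset.card_lt_card (t := Finset.range S.length) ⟨Finset.filter_subset _ _, ?_⟩).trans_eq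
    (Finset.card_range _)
  intro hsub
  obtain ⟨-, x, hx, hwx⟩ := mem_hitTimes.mp (hsub (Finset.mem_range.mpr hi))
  refine hmiss ⟨x, List.mem_toFinset.mp (Finset.mem_filter.mp hx).1, ?_⟩
  simp only [hmove i hi] at hwx
  exact hwx
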